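/- An eta product f(q) = ∏_{m|N} η(q^m)^{a_m} of level N transforms as a modular form on Γ₀(N) of weight k = (1/2) Σ_{m|N} a_m. -/

import Mathlib

/-!
STATEMENT 15: An eta product `f(q) = ∏_{m|N} η(q^m)^{a_m}` of level `N` transforms
as a modular form on `Γ₀(N)` of weight `k = (1/2) Σ_{m|N} a_m` (with some multiplier
system `v`).

Here `η` is the Dedekind eta function, defined on the upper half-plane via
`η(τ) = e^{πiτ/12} ∏_{n≥1} (1 − e^{2πinτ})` (so `q = e^{2πiτ}` and
`η(q^m) = η(mτ)`), and "transforms as a modular form of weight k with multiplier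
system" means: there is `v : Γ₀(N) → ℂ` with
`f(Lτ) = v(L) (cτ+d)^k f(τ)` for all `L = (a b; c d) ∈ Γ₀(N)`, the (possibly
half-integral) power `(cτ+d)^k` being taken with the principal branch.
-/

open Complex

/-- The Dedekind eta function as a function of `z` in the upper half-plane
(`q = exp(2πiz)`): `η(z) = q^{1/24} ∏_{n ≥ 1} (1 − qⁿ)`. -/
noncomputable def dedekindEta (z : ℂ) : ℂ :=
  Complex.exp (Real.pi * Complex.I * z / 12) *
    ∏' n : ℕ, (1 - Complex.exp (2 * Real.pi * Complex.I * (n + 1) * z))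

open UpperHalfPlane ModularForm EisensteinSeries in
lemma eta_eq_dedekind (z : ℂ) : dedekindEta z = ModularForm.eta z := by
  unfold dedekindEta ModularForm.eta
  congr 1
  · simp only [Function.Periodic.qParam]
    congr 1
    push_cast
    ring
  · refine tprod_congr fun n ↦ ?_
    rw [eta_q_eq_cexp]

lemma denom_ne (γ : Matrix.SpecialLinearGroup (Fin 2) ℤ) {z : ℂ} (hz : 0 < z.im) :
    ((γ 1 0 : ℤ) : ℂ) * z + ((γ 1 1 : ℤ) : ℂ) ≠ 0 := by
  have := UpperHalfPlane.denom_ne_zero (γ : GL (Fin 2) ℝ) ⟨z, hz⟩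
  rwa [ModularGroup.denom_apply] at this

lemma hasDerivAt_sqrt_denom (γ : Matrix.SpecialLinearGroup (Fin 2) ℤ) {z : ℂ} (hz : 0 < z.im) :
    HasDerivAt (fun w : ℂ ↦ (((γ 1 0 : ℤ) : ℂ) * w + ((γ 1 1 : ℤ) : ℂ)) ^ (1 / 2 : ℂ))
      ((((γ 1 0 : ℤ) : ℂ) * z + ((γ 1 1 : ℤ) : ℂ)) ^ (1 / 2 : ℂ) *
        (((γ 1 0 : ℤ) : ℂ) / (2 * (((γ 1 0 : ℤ) : ℂ) * z + ((γ 1 1 : ℤ) : ℂ))))) z := by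
  have hne := denom_ne γ hz
  by_cases hc : γ 1 0 = 0
  · simp only [hc, Int.cast_zero, zero_mul, zero_add, zero_div, mul_zero]
    exact hasDerivAt_const _ _
  · have hs : ((γ 1 0 : ℤ) : ℂ) * z + ((γ 1 1 : ℤ) : ℂ) ∈ Complex.slitPlane := by
      right
      simp [hc, hz.ne']
    have h1 : HasDerivAt (fun w : ℂ ↦ ((γ 1 0 : ℤ) : ℂ) * w + ((γ 1 1 : ℤ) : ℂ))
        ((γ 1 0 : ℤ) : ℂ) z := by
      simpa using ((hasDerivAt_id z).const_mul ((γ 1 0 : ℤ) : ℂ)).add_const ((γ 1 1 : ℤ) : ℂ)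
    convert h1.cpow_const (c := 1 / 2) hs using 1
    rw [Complex.cpow_sub _ _ hne, Complex.cpow_one]
    field_simp

lemma hasDerivAt_moeb (γ : Matrix.SpecialLinearGroup (Fin 2) ℤ) {z : ℂ} (hz : 0 < z.im) :
    HasDerivAt (fun w : ℂ ↦ (((γ 0 0 : ℤ) : ℂ) * w + ((γ 0 1 : ℤ) : ℂ)) /
        (((γ 1 0 : ℤ) : ℂ) * w + ((γ 1 1 : ℤ) : ℂ)))
      (1 / (((γ 1 0 : ℤ) : ℂ) * z + ((γ 1 1 : ℤ) : ℂ)) ^ 2) z := by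
  have h1 (a b : ℂ) : HasDerivAt (fun w : ℂ ↦ a * w + b) a z := by
    simpa using ((hasDerivAt_id z).const_mul a).add_const b
  refine ((h1 ((γ 0 0 : ℤ) : ℂ) ((γ 0 1 : ℤ) : ℂ)).fun_div
    (h1 ((γ 1 0 : ℤ) : ℂ) ((γ 1 1 : ℤ) : ℂ)) (denom_ne γ hz)).congr_deriv ?_
  congr 1
  have := γ.det_coe
  rw [Matrix.det_fin_two] at this
  have h2 : ((γ 0 0 : ℤ) : ℂ) * ((γ 1 1 : ℤ) : ℂ) - ((γ 0 1 : ℤ) : ℂ) * ((γ 1 0 : ℤ) : ℂ) = 1 := by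
    exact_mod_cast this
  linear_combination h2

lemma moeb_eq (γ : Matrix.SpecialLinearGroup (Fin 2) ℤ) (z : UpperHalfPlane) :
    ((γ • z : UpperHalfPlane) : ℂ) = (((γ 0 0 : ℤ) : ℂ) * z + ((γ 0 1 : ℤ) : ℂ)) /
        (((γ 1 0 : ℤ) : ℂ) * z + ((γ 1 1 : ℤ) : ℂ)) := by
  rw [UpperHalfPlane.coe_specialLinearGroup_apply]
  simp

open UpperHalfPlane ModularForm EisensteinSeries in
lemma eta_transform (γ : Matrix.SpecialLinearGroup (Fin 2) ℤ) :
    ∃ c : ℂ, ∀ z : UpperHalfPlane, ModularForm.eta ((γ • z : UpperHalfPlane) : ℂ) =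
      c * ((((γ 1 0 : ℤ) : ℂ) * z + ((γ 1 1 : ℤ) : ℂ)) ^ (1 / 2 : ℂ) * ModularForm.eta z) := by
  set M : ℂ → ℂ := fun w : ℂ ↦ (((γ 0 0 : ℤ) : ℂ) * w + ((γ 0 1 : ℤ) : ℂ)) /
        (((γ 1 0 : ℤ) : ℂ) * w + ((γ 1 1 : ℤ) : ℂ)) with hM
  set J : ℂ → ℂ := fun w : ℂ ↦ (((γ 1 0 : ℤ) : ℂ) * w + ((γ 1 1 : ℤ) : ℂ)) ^ (1 / 2 : ℂ) with hJ
  have hMz (z : ℂ) (hz : 0 < z.im) : M z = ((γ • (⟨z, hz⟩ : UpperHalfPlane) : UpperHalfPlane) : ℂ) :=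
    (moeb_eq γ ⟨z, hz⟩).symm
  have hMim (z : ℂ) (hz : 0 < z.im) : 0 < (M z).im := by
    rw [hMz z hz]; exact (γ • (⟨z, hz⟩ : UpperHalfPlane)).im_pos
  have hJ0 (z : ℂ) (hz : 0 < z.im) : J z ≠ 0 := by
    simp only [hJ]
    rw [Complex.cpow_def_of_ne_zero (denom_ne γ hz)]
    exact Complex.exp_ne_zero _
  have hηd (z : ℂ) (hz : 0 < z.im) : DifferentiableAt ℂ ModularForm.eta z :=
    differentiableAt_eta_of_mem_upperHalfPlaneSet hz
  have key : ∃ c : ℂ, c ≠ 0 ∧ upperHalfPlaneSet.EqOn (ModularForm.eta ∘ M) (c • (J * ModularForm.eta)) := by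
    rw [← logDeriv_eqOn_iff]
    · intro z hz
      have hz : 0 < z.im := hz
      have hne := denom_ne γ hz
      have hE2 := congrFun (E2_slash_action γ) ⟨z, hz⟩
      have hp : (Real.pi : ℂ) ≠ 0 := by exact_mod_cast Real.pi_ne_zero
      rw [logDeriv_comp (hηd _ (hMim z hz)) (hasDerivAt_moeb γ hz).differentiableAt,
        (hasDerivAt_moeb γ hz).deriv, Pi.mul_def,
        logDeriv_mul _ (hJ0 z hz) (eta_ne_zero hz)
          (hasDerivAt_sqrt_denom γ hz).differentiableAt (hηd z hz),
        logDeriv_apply J, (hasDerivAt_sqrt_denom γ hz).deriv, hMz z hz, logDeriv_eta_eq_E2,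
        show logDeriv ModularForm.eta z = _ from logDeriv_eta_eq_E2 ⟨z, hz⟩]
      rw [SL_slash_def] at hE2
      simp only [riemannZeta_two, Pi.sub_apply, Pi.smul_apply, D2, smul_eq_mul] at hE2
      have hden : denom (γ : GL (Fin 2) ℝ) z = ((γ 1 0 : ℤ) : ℂ) * z + ((γ 1 1 : ℤ) : ℂ) :=
        ModularGroup.denom_apply γ ⟨z, hz⟩
      rw [hden] at hE2
      change _ = (J z * _) / J z + _
      rw [mul_div_cancel_left₀ _ (hJ0 z hz)]
      have hz2 : (((γ 1 0 : ℤ) : ℂ) * z + ((γ 1 1 : ℤ) : ℂ)) ^ (-2 : ℤ) =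
          1 / (((γ 1 0 : ℤ) : ℂ) * z + ((γ 1 1 : ℤ) : ℂ)) ^ 2 := by
        rw [zpow_neg, one_div]
        rfl
      rw [hz2] at hE2
      rw [mul_assoc, hE2]
      field_simp
      ring_nf
      simp only [Complex.I_sq]
      ring
    · intro z hz
      exact ((hηd _ (hMim z hz)).comp z (hasDerivAt_moeb γ hz).differentiableAt).differentiableWithinAt
    · intro z hz
      exact ((hasDerivAt_sqrt_denom γ hz).differentiableAt.mul (hηd z hz)).differentiableWithinAt
    · exact isOpen_upperHalfPlaneSet
    · exact Convex.isPreconnected (convex_halfSpace_im_gt 0)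
    · exact fun x hx ↦ mul_ne_zero (hJ0 x hx) (eta_ne_zero hx)
    · exact fun x hx ↦ eta_ne_zero (hMim x hx)
  obtain ⟨c, -, hc⟩ := key
  refine ⟨c, fun z ↦ ?_⟩
  have := hc z.2
  rw [moeb_eq]
  simpa only [hM, hJ, Function.comp_apply, Pi.smul_apply, Pi.mul_apply, smul_eq_mul] using this

lemma eta_factor (N m : ℕ) (hN : 1 ≤ N) (hm : m ∈ N.divisors) (L : CongruenceSubgroup.Gamma0 N) :
    ∃ c : ℂ, ∀ τ : UpperHalfPlane,
      dedekindEta (m * (((L : Matrix.SpecialLinearGroup (Fin 2) ℤ) • τ : UpperHalfPlane) : ℂ)) =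
        c * (((((L : Matrix.SpecialLinearGroup (Fin 2) ℤ) 1 0 : ℤ) : ℂ) * τ +
          (((L : Matrix.SpecialLinearGroup (Fin 2) ℤ) 1 1 : ℤ) : ℂ)) ^ (1 / 2 : ℂ) *
          dedekindEta (m * (τ : ℂ))) := by
  obtain ⟨γ, hγ⟩ := L
  have hmN := Nat.dvd_of_mem_divisors hm
  have hm0 : 0 < m := Nat.pos_of_mem_divisors hm
  have hd : (m : ℤ) ∣ γ 1 0 := by
    rw [CongruenceSubgroup.Gamma0_mem, ZMod.intCast_zmod_eq_zero_iff_dvd] at hγ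
    exact (Int.natCast_dvd_natCast.mpr hmN).trans hγ
  obtain ⟨e, he⟩ := hd
  have hdet := γ.det_coe
  rw [Matrix.det_fin_two] at hdet
  let γ' : Matrix.SpecialLinearGroup (Fin 2) ℤ :=
    ⟨!![γ 0 0, m * γ 0 1; e, γ 1 1], by
      rw [Matrix.det_fin_two_of]
      rw [he] at hdet
      linarith⟩
  obtain ⟨c, hc⟩ := eta_transform γ'
  refine ⟨c, fun τ ↦ ?_⟩
  have hmτ : 0 < ((m : ℂ) * (τ : ℂ)).im := by
    simpa using mul_pos (Nat.cast_pos.mpr hm0) τ.im_pos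
  have h := hc ⟨_, hmτ⟩
  rw [moeb_eq] at h
  rw [moeb_eq, eta_eq_dedekind, eta_eq_dedekind]
  have e00 : γ' 0 0 = γ 0 0 := rfl
  have e01 : γ' 0 1 = m * γ 0 1 := rfl
  have e10 : γ' 1 0 = e := rfl
  have e11 : γ' 1 1 = γ 1 1 := rfl
  have hden : ((e : ℤ) : ℂ) * ((m : ℂ) * τ) = ((γ 1 0 : ℤ) : ℂ) * τ := by
    rw [he]; push_cast; ring
  rw [e00, e01, e10, e11] at h
  simp only [hden] at h
  rw [← h]
  congr 1
  push_cast
  ring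

theorem stmt_15 (N : ℕ) (hN : 1 ≤ N) (a : ℕ → ℤ)
    (f : UpperHalfPlane → ℂ)
    (hf : ∀ τ : UpperHalfPlane,
      f τ = ∏ m ∈ N.divisors, (dedekindEta (m * (τ : ℂ))) ^ (a m))
    (k : ℚ) (hk : k = (1/2 : ℚ) * ∑ m ∈ N.divisors, (a m : ℚ)) :
    ∃ v : CongruenceSubgroup.Gamma0 N → ℂ,
      ∀ (L : CongruenceSubgroup.Gamma0 N) (τ : UpperHalfPlane),
        f ((L : Matrix.SpecialLinearGroup (Fin 2) ℤ) • τ) =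
          v L * ((((L : Matrix.SpecialLinearGroup (Fin 2) ℤ) :
              Matrix (Fin 2) (Fin 2) ℤ) 1 0 : ℂ) * (τ : ℂ) +
            (((L : Matrix.SpecialLinearGroup (Fin 2) ℤ) :
              Matrix (Fin 2) (Fin 2) ℤ) 1 1 : ℂ)) ^ (k : ℂ) * f τ := by
  classical
  choose! c hc using fun (L : CongruenceSubgroup.Gamma0 N) (m : ℕ) (hm : m ∈ N.divisors) ↦
    eta_factor N m hN hm L
  refine ⟨fun L ↦ ∏ m ∈ N.divisors, c L m ^ a m, fun L τ ↦ ?_⟩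
  have hne := denom_ne (L : Matrix.SpecialLinearGroup (Fin 2) ℤ) τ.im_pos
  rw [hf, hf, Finset.prod_congr rfl fun m hm ↦ by rw [hc L m hm τ, mul_zpow, mul_zpow],
    Finset.prod_mul_distrib, Finset.prod_mul_distrib, ← mul_assoc]
  congr 2
  have hk' : (k : ℂ) = (1 / 2 : ℂ) * ((∑ m ∈ N.divisors, a m : ℤ) : ℂ) := by
    rw [hk]; push_cast; ring
  rw [hk', Complex.cpow_mul_int, Complex.cpow_def_of_ne_zero hne]
  induction N.divisors using Finset.induction_on with
  | empty => simp
  | insert x s hx ih =>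
    rw [Finset.prod_insert hx, Finset.sum_insert hx, zpow_add₀ (Complex.exp_ne_zero _), ih]
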